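/- arXiv:2002.08843 — 2 statements merged into one kernel-verified Lean document; each statement's English description precedes it below -/
import Mathlib

section
/- Let N = 2n + 1 + n(n+1)/2 (the dimension of Z). For every z ∈ U there exists z̄ ∈ Λ such that the segment [z − z̄, z + z̄] = {z + t·z̄ : t ∈ [−1, 1]} is contained in U and |π(z̄)| ≥ (1/(2N))·dist(π(z), π(K)), where dist denotes the Euclidean distance from the point π(z) to the set π(K). -/
noncomputable section

open Matrix

abbrev En (n : ℕ) := EuclideanSpace ℝ (Fin n)

/-- The space of symmetric trace-free `n × n` real matrices, as a submodule. -/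
def S0 (n : ℕ) : Submodule ℝ (Matrix (Fin n) (Fin n) ℝ) where
  carrier := {σ | σ.IsSymm ∧ σ.trace = 0}
  add_mem' := fun hA hB => ⟨hA.1.add hB.1, by simp [Matrix.trace_add, hA.2, hB.2]⟩
  zero_mem' := ⟨Matrix.isSymm_zero, by simp⟩
  smul_mem' := fun c A hA => ⟨by rw [Matrix.IsSymm, Matrix.transpose_smul, hA.1], by simp [hA.2]⟩

/-- The state space `Z = ℝ × ℝⁿ × ℝⁿ × S₀ × ℝ`. -/
abbrev Zsp (n : ℕ) := ℝ × En n × En n × ↥(S0 n) × ℝ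

/-- Outer product `w ⊗ m`. -/
def op {n : ℕ} (w m : En n) : Matrix (Fin n) (Fin n) ℝ := fun i j => w i * m j

/-- The largest eigenvalue of a (symmetric) matrix, as `sup {ξᵀ A ξ : |ξ| = 1}`. -/
def lamMax {n : ℕ} (A : Matrix (Fin n) (Fin n) ℝ) : ℝ :=
  sSup {r | ∃ ξ : En n, ‖ξ‖ = 1 ∧ r = ∑ i, ∑ j, ξ i * A i j * ξ j}

/-- The matrix `M(z)`. -/
def Mmat {n : ℕ} (μm μp μ : ℝ) (w m : En n) (σ : Matrix (Fin n) (Fin n) ℝ) :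
    Matrix (Fin n) (Fin n) ℝ :=
  (((μp - μ) * (μ - μm))⁻¹) •
      ((μ * μm * μp) • op w w - (μm * μp) • (op m w + op w m) + (μp + μm - μ) • op m m) - σ

/-- `T₊(z)`. -/
def Tp {n : ℕ} (μm μp μ : ℝ) (w m : En n) : ℝ :=
  (μp / (n : ℝ)) * ‖m - μm • w‖ ^ 2 / (μ - μm) ^ 2

/-- `T₋(z)`. -/
def Tm {n : ℕ} (μm μp μ : ℝ) (w m : En n) : ℝ :=
  (μm / (n : ℝ)) * ‖m - μp • w‖ ^ 2 / (μ - μp) ^ 2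

def TpZ {n : ℕ} (μm μp : ℝ) (z : Zsp n) : ℝ := Tp μm μp z.1 z.2.1 z.2.2.1

def TmZ {n : ℕ} (μm μp : ℝ) (z : Zsp n) : ℝ := Tm μm μp z.1 z.2.1 z.2.2.1

def QZ {n : ℕ} (μm μp : ℝ) (z : Zsp n) : ℝ :=
  lamMax (Mmat μm μp z.1 z.2.1 z.2.2.1 (z.2.2.2.1 : Matrix (Fin n) (Fin n) ℝ))

/-- The open relaxed set `U`. -/
def Uset (n : ℕ) (μm μp e : ℝ) : Set (Zsp n) :=
  {z | z.1 ∈ Set.Ioo μm μp ∧ TpZ μm μp z < e ∧ TmZ μm μp z < e ∧ QZ μm μp z < e}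

/-- The constraint set `K`. -/
def Kset (n : ℕ) (μm μp e : ℝ) : Set (Zsp n) :=
  {z | (z.1 = μm ∨ z.1 = μp) ∧ z.2.2.1 = z.1 • z.2.1 ∧
    z.1 • op z.2.1 z.2.1 - (z.2.2.2.1 : Matrix (Fin n) (Fin n) ℝ) =
      e • (1 : Matrix (Fin n) (Fin n) ℝ)}

/-- The wave cone `Λ`. -/
def Lambda (n : ℕ) : Set (Zsp n) :=
  {z | ¬(z.1 = 0 ∧ z.2.2.1 = 0) ∧
    ∃ (ξ : Fin n → ℝ) (c : ℝ), ¬(ξ = 0 ∧ c = 0) ∧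
      ((z.2.2.2.1 : Matrix (Fin n) (Fin n) ℝ) +
          z.2.2.2.2 • (1 : Matrix (Fin n) (Fin n) ℝ)).mulVec ξ + c • (fun i => z.2.2.1 i) = 0 ∧
      (∑ j, z.2.2.1 j * ξ j) + c * z.1 = 0 ∧
      (∑ j, z.2.1 j * ξ j) = 0}

/-- The projection `π(μ, w, m, σ, q) = (μ, w, m, σ)`. -/
def pz {n : ℕ} (z : Zsp n) : ℝ × En n × En n × ↥(S0 n) := (z.1, z.2.1, z.2.2.1, z.2.2.2.1)

/-- The Euclidean norm on `π(Z) = ℝ × ℝⁿ × ℝⁿ × S₀` (Frobenius norm on the matrix part). -/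
def pnormE {n : ℕ} (p : ℝ × En n × En n × ↥(S0 n)) : ℝ :=
  Real.sqrt (p.1 ^ 2 + ‖p.2.1‖ ^ 2 + ‖p.2.2.1‖ ^ 2 +
    ∑ i, ∑ j, ((p.2.2.2 : Matrix (Fin n) (Fin n) ℝ) i j) ^ 2)

/-- The quadratic form of a matrix. -/
def quadForm {n : ℕ} (A : Matrix (Fin n) (Fin n) ℝ) (ξ : En n) : ℝ :=
  ∑ i, ∑ j, ξ i * A i j * ξ j

lemma quadForm_add {n : ℕ} (A B : Matrix (Fin n) (Fin n) ℝ) (ξ : En n) :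
    quadForm (A + B) ξ = quadForm A ξ + quadForm B ξ := by
  simp only [quadForm, Matrix.add_apply, mul_add, add_mul, Finset.sum_add_distrib]

lemma quadForm_smul {n : ℕ} (c : ℝ) (A : Matrix (Fin n) (Fin n) ℝ) (ξ : En n) :
    quadForm (c • A) ξ = c * quadForm A ξ := by
  simp only [quadForm, Matrix.smul_apply, smul_eq_mul, Finset.mul_sum]
  exact Finset.sum_congr rfl fun i _ => Finset.sum_congr rfl fun j _ => by ring

lemma quadForm_sub {n : ℕ} (A B : Matrix (Fin n) (Fin n) ℝ) (ξ : En n) :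
    quadForm (A - B) ξ = quadForm A ξ - quadForm B ξ := by
  rw [sub_eq_add_neg, quadForm_add, ← neg_one_smul ℝ B, quadForm_smul]
  ring

lemma quadForm_op {n : ℕ} (u v ξ : En n) :
    quadForm (op u v) ξ = inner ℝ ξ u * inner ℝ ξ v := by
  simp only [quadForm, op, PiLp.inner_apply, Finset.sum_mul_sum, RCLike.inner_apply, conj_trivial]
  exact Finset.sum_congr rfl fun i _ => Finset.sum_congr rfl fun j _ => by ring

lemma quadForm_one {n : ℕ} (ξ : En n) :
    quadForm (1 : Matrix (Fin n) (Fin n) ℝ) ξ = ‖ξ‖ ^ 2 := by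
  simp [quadForm, Matrix.one_apply, EuclideanSpace.real_norm_sq_eq, ← sq, mul_comm]

lemma trace_op {n : ℕ} (u v : En n) : (op u v).trace = inner ℝ u v := by
  simp [Matrix.trace, op, PiLp.inner_apply, mul_comm]

lemma op_transpose {n : ℕ} (u v : En n) : (op u v)ᵀ = op v u := by
  ext i j
  simp [op, mul_comm]

lemma bddAbove_quadForm {n : ℕ} (A : Matrix (Fin n) (Fin n) ℝ) :
    BddAbove {r | ∃ ξ : En n, ‖ξ‖ = 1 ∧ r = ∑ i, ∑ j, ξ i * A i j * ξ j} := by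
  refine ⟨∑ i, ∑ j, |A i j|, ?_⟩
  rintro r ⟨ξ, hξ, rfl⟩
  have hb : ∀ i, |ξ i| ≤ 1 := fun i => by
    have := PiLp.norm_apply_le ξ i
    rwa [hξ, Real.norm_eq_abs] at this
  refine Finset.sum_le_sum fun i _ => Finset.sum_le_sum fun j _ => ?_
  calc ξ i * A i j * ξ j ≤ |ξ i * A i j * ξ j| := le_abs_self _
    _ = |ξ i| * |A i j| * |ξ j| := by rw [abs_mul, abs_mul]
    _ ≤ 1 * |A i j| * 1 := by gcongr <;> exact hb _
    _ = |A i j| := by ring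

lemma quadForm_le_lamMax {n : ℕ} (A : Matrix (Fin n) (Fin n) ℝ) {ξ : En n} (hξ : ‖ξ‖ = 1) :
    quadForm A ξ ≤ lamMax A :=
  le_csSup (bddAbove_quadForm A) ⟨ξ, hξ, rfl⟩

lemma lamMax_le {n : ℕ} (hn : 0 < n) (A : Matrix (Fin n) (Fin n) ℝ) {c : ℝ}
    (h : ∀ ξ : En n, ‖ξ‖ = 1 → quadForm A ξ ≤ c) : lamMax A ≤ c := by
  refine csSup_le ⟨_, EuclideanSpace.single ⟨0, hn⟩ 1, by simp, rfl⟩ ?_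
  rintro r ⟨ξ, hξ, rfl⟩
  exact h ξ hξ

/-- A symmetric matrix with nonnegative quadratic form is a nonnegative combination of rank-one
projections, with coefficients summing to the trace. -/
lemma exists_rank_one_decomposition {n : ℕ} (A : Matrix (Fin n) (Fin n) ℝ) (hA : A.IsSymm)
    (hpos : ∀ ξ : En n, ‖ξ‖ = 1 → 0 ≤ quadForm A ξ) :
    ∃ (c : Fin n → ℝ) (a : Fin n → En n), (∀ i, 0 ≤ c i) ∧ (∀ i, ‖a i‖ = 1) ∧
      ∑ i, c i = A.trace ∧ A = ∑ i, c i • op (a i) (a i) := by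
  have hH : A.IsHermitian := by
    rw [Matrix.IsHermitian, Matrix.conjTranspose_eq_transpose_of_trivial, hA]
  refine ⟨hH.eigenvalues, fun i => hH.eigenvectorBasis i, fun i => ?_,
    fun i => hH.eigenvectorBasis.orthonormal.1 i, ?_, ?_⟩
  · have h := hpos _ (hH.eigenvectorBasis.orthonormal.1 i)
    have h2 := hH.eigenvalues_eq i
    rw [h2]
    convert h using 1
    simp [quadForm, dotProduct, Matrix.mulVec, Finset.mul_sum, mul_assoc]
  · rw [hH.trace_eq_sum_eigenvalues]; simp
  · ext i j
    have h := congrFun (congrFun hH.spectral_theorem i) j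
    rw [h, Matrix.sum_apply]
    simp [Unitary.conjStarAlgAut_apply, Matrix.mul_apply, Matrix.diagonal_apply, op,
      Matrix.star_apply]
    exact Finset.sum_congr rfl fun k _ => by ring

/-- A vector `v` inside a sphere is a mean of two points of the sphere on the line in
direction `a`, with covariance proportional to `a ⊗ a`. -/
lemma exists_two_point_splitting {n : ℕ} {R : ℝ} (v a : En n) (ha : ‖a‖ = 1)
    (hv : ‖v‖ ^ 2 < R) :
    ∃ (w : Bool → En n) (θ : Bool → ℝ), (∀ b, 0 ≤ θ b) ∧ (∀ b, ‖w b‖ ^ 2 = R) ∧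
      ∑ b, θ b = 1 ∧ ∑ b, θ b • w b = v ∧
      ∑ b, θ b • op (w b) (w b) = op v v + (R - ‖v‖ ^ 2) • op a a := by
  set p : ℝ := inner ℝ v a with hp
  set D : ℝ := Real.sqrt (p ^ 2 + (R - ‖v‖ ^ 2)) with hD
  have hD2 : D ^ 2 = p ^ 2 + (R - ‖v‖ ^ 2) := Real.sq_sqrt (by nlinarith [sq_nonneg p])
  have hDpos : 0 < D := Real.sqrt_pos.2 (by nlinarith [sq_nonneg p])
  have habs : |p| < D := abs_lt_of_sq_lt_sq (by linarith) hDpos.le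
  have h1 := (abs_lt.1 habs).1
  have h2 := (abs_lt.1 habs).2
  have hnorm : ∀ r : ℝ, ‖v + r • a‖ ^ 2 = ‖v‖ ^ 2 + 2 * r * p + r ^ 2 := fun r => by
    rw [norm_add_sq_real, norm_smul, mul_pow, ha, inner_smul_right, Real.norm_eq_abs, sq_abs]
    ring
  refine ⟨fun b => v + (if b then -p + D else -p - D) • a,
    fun b => if b then (D + p) / (2 * D) else (D - p) / (2 * D), ?_, ?_, ?_, ?_, ?_⟩
  · rintro (_ | _)
    · exact div_nonneg (by simp; linarith) (by linarith)
    · exact div_nonneg (by linarith) (by linarith)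
  · rintro (_ | _)
    · simp only [hnorm, Bool.false_eq_true, if_false]; linear_combination hD2
    · simp only [hnorm, if_true]; linear_combination hD2
  · simp only [Fintype.sum_bool, if_true, Bool.false_eq_true, if_false]
    field_simp; ring
  · ext i
    simp
    field_simp; ring
  · ext i j
    simp [op]
    field_simp
    linear_combination (2 * D * a i * a j) * hD2

/-- An affine minorant of the quadratic form of `Mmat`, indexed by `c` and `d`. -/
def affineMinorant {n : ℕ} (μm μp c d : ℝ) (ξ : En n) (z : Zsp n) : ℝ :=
  (μp * (2 * c * (inner ℝ ξ z.2.2.1 - μm * inner ℝ ξ z.2.1) - c ^ 2 * (z.1 - μm)) +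
      μm * (2 * d * (μp * inner ℝ ξ z.2.1 - inner ℝ ξ z.2.2.1) - d ^ 2 * (μp - z.1))) / (μp - μm) -
    quadForm (z.2.2.2.1 : Matrix (Fin n) (Fin n) ℝ) ξ

/-- A convex set cut out by the closed counterparts of the inequalities defining `Uset`. -/
def closedHull (n : ℕ) (μm μp e : ℝ) : Set (Zsp n) :=
  {z | μm ≤ z.1 ∧ z.1 ≤ μp ∧
    √μp * ‖z.2.2.1 - μm • z.2.1‖ ≤ √(n * e) * (z.1 - μm) ∧
    √μm * ‖z.2.2.1 - μp • z.2.1‖ ≤ √(n * e) * (μp - z.1) ∧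
    ∀ (ξ : En n) (c d : ℝ), ‖ξ‖ = 1 → affineMinorant μm μp c d ξ z ≤ e}

lemma affineMinorant_convex_comb {n : ℕ} (μm μp c d : ℝ) (ξ : En n) (x y : Zsp n) {a b : ℝ}
    (hab : a + b = 1) :
    affineMinorant μm μp c d ξ (a • x + b • y) =
      a * affineMinorant μm μp c d ξ x + b * affineMinorant μm μp c d ξ y := by
  obtain rfl : a = 1 - b := by linarith
  simp only [affineMinorant, Prod.fst_add, Prod.snd_add, Prod.smul_fst, Prod.smul_snd,
    Submodule.coe_add, Submodule.coe_smul, quadForm_add, quadForm_smul, inner_add_right,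
    inner_smul_right, smul_eq_mul]
  ring

lemma norm_convex_comb_sub_le {E : Type*} [NormedAddCommGroup E] [NormedSpace ℝ E] (κ : ℝ)
    (m w m' w' : E) {a b : ℝ} (ha : 0 ≤ a) (hb : 0 ≤ b) :
    ‖(a • m + b • m') - κ • (a • w + b • w')‖ ≤ a * ‖m - κ • w‖ + b * ‖m' - κ • w'‖ := by
  have h : (a • m + b • m') - κ • (a • w + b • w') = a • (m - κ • w) + b • (m' - κ • w') := by
    module
  rw [h]
  refine (norm_add_le _ _).trans_eq ?_
  rw [norm_smul, norm_smul, Real.norm_of_nonneg ha, Real.norm_of_nonneg hb]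

lemma convex_closedHull (n : ℕ) (μm μp e : ℝ) : Convex ℝ (closedHull n μm μp e) := by
  rintro x ⟨hx1, hx2, hx3, hx4, hx5⟩ y ⟨hy1, hy2, hy3, hy4, hy5⟩ a b ha hb hab
  obtain rfl : a = 1 - b := by linarith
  refine ⟨?_, ?_, ?_, ?_, fun ξ c d hξ => ?_⟩
  · simp only [Prod.fst_add, Prod.smul_fst, smul_eq_mul]
    nlinarith
  · simp only [Prod.fst_add, Prod.smul_fst, smul_eq_mul]
    nlinarith
  · have h := mul_le_mul_of_nonneg_left
      (norm_convex_comb_sub_le μm x.2.2.1 x.2.1 y.2.2.1 y.2.1 ha hb) (Real.sqrt_nonneg μp)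
    refine h.trans ?_
    simp only [Prod.fst_add, Prod.smul_fst, smul_eq_mul]
    linarith [mul_le_mul_of_nonneg_left hx3 ha, mul_le_mul_of_nonneg_left hy3 hb]
  · have h := mul_le_mul_of_nonneg_left
      (norm_convex_comb_sub_le μp x.2.2.1 x.2.1 y.2.2.1 y.2.1 ha hb) (Real.sqrt_nonneg μm)
    refine h.trans ?_
    simp only [Prod.fst_add, Prod.smul_fst, smul_eq_mul]
    linarith [mul_le_mul_of_nonneg_left hx4 ha, mul_le_mul_of_nonneg_left hy4 hb]
  · rw [affineMinorant_convex_comb _ _ _ _ _ _ _ hab]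
    linarith [mul_le_mul_of_nonneg_left (hx5 ξ c d hξ) ha,
      mul_le_mul_of_nonneg_left (hy5 ξ c d hξ) hb]

lemma Kset_norm_sq {n : ℕ} {μm μp e : ℝ} {z : Zsp n} (hz : z ∈ Kset n μm μp e) :
    z.1 * ‖z.2.1‖ ^ 2 = n * e := by
  have h := congrArg Matrix.trace hz.2.2
  rw [Matrix.trace_sub, Matrix.trace_smul, Matrix.trace_smul, trace_op, z.2.2.2.1.2.2,
    real_inner_self_eq_norm_sq, Matrix.trace_one] at h
  simp at h
  linarith

lemma sqrt_mul_norm_eq {E : Type*} [NormedAddCommGroup E] {κ R : ℝ} (hκ : 0 ≤ κ) {w : E}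
    (h : κ * ‖w‖ ^ 2 = R) : √κ * ‖w‖ = √R := by
  rw [← h, Real.sqrt_mul hκ, Real.sqrt_sq (norm_nonneg w)]

lemma Kset_subset_closedHull {n : ℕ} {μm μp e : ℝ} (hμm : 0 < μm) (hμ : μm < μp) :
    Kset n μm μp e ⊆ closedHull n μm μp e := by
  intro z hz
  have hw := Kset_norm_sq hz
  obtain ⟨h1, hm, hσ⟩ := hz
  have hs : 0 < μp - μm := sub_pos.2 hμ
  have hq : ∀ ξ : En n, ‖ξ‖ = 1 → quadForm (z.2.2.2.1 : Matrix (Fin n) (Fin n) ℝ) ξ =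
      z.1 * (inner ℝ ξ z.2.1) ^ 2 - e := fun ξ hξ => by
    have h := congrArg (fun A => quadForm A ξ) hσ
    simp only [quadForm_sub, quadForm_smul, quadForm_op, quadForm_one, hξ] at h
    linarith
  have hsq : √z.1 * ‖z.2.1‖ = √(n * e) := sqrt_mul_norm_eq (by rcases h1 with h | h <;> linarith) hw
  rcases h1 with h | h
  · refine ⟨h.ge, by linarith, ?_, ?_, fun ξ c d hξ => ?_⟩
    · rw [hm, h]; simp
    · rw [hm, ← hsq, h, ← sub_smul, norm_smul, Real.norm_eq_abs, abs_sub_comm, abs_of_pos hs]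
      exact le_of_eq (by ring)
    · rw [affineMinorant, hq ξ hξ, hm, inner_smul_right, h, sub_le_iff_le_add, div_le_iff₀ hs]
      nlinarith [mul_nonneg (mul_nonneg hμm.le hs.le) (sq_nonneg (d - inner ℝ ξ z.2.1))]
  · refine ⟨by linarith, h.le, ?_, ?_, fun ξ c d hξ => ?_⟩
    · rw [hm, ← hsq, h, ← sub_smul, norm_smul, Real.norm_eq_abs, abs_of_pos hs]
      exact le_of_eq (by ring)
    · rw [hm, h]; simp
    · rw [affineMinorant, hq ξ hξ, hm, inner_smul_right, h, sub_le_iff_le_add, div_le_iff₀ hs]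
      nlinarith [mul_nonneg (mul_nonneg (hμm.trans hμ).le hs.le) (sq_nonneg (c - inner ℝ ξ z.2.1))]

lemma quadForm_Mmat {n : ℕ} (μm μp μ : ℝ) (w m ξ : En n) (σ : Matrix (Fin n) (Fin n) ℝ) :
    quadForm (Mmat μm μp μ w m σ) ξ =
      ((μp - μ) * (μ - μm))⁻¹ * (μ * μm * μp * inner ℝ ξ w ^ 2 -
        2 * (μm * μp) * (inner ℝ ξ m * inner ℝ ξ w) + (μp + μm - μ) * inner ℝ ξ m ^ 2) -
        quadForm σ ξ := by
  simp only [Mmat, quadForm_sub, quadForm_smul, quadForm_add, quadForm_op]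
  ring

lemma quadForm_Mmat_eq_affineMinorant_add {n : ℕ} {μm μp : ℝ} (z : Zsp n) (ξ : En n) (c d : ℝ)
    (h1 : μm < z.1) (h2 : z.1 < μp) :
    quadForm (Mmat μm μp z.1 z.2.1 z.2.2.1 (z.2.2.2.1 : Matrix (Fin n) (Fin n) ℝ)) ξ =
      affineMinorant μm μp c d ξ z +
      (μp * (z.1 - μm) * (c - (inner ℝ ξ z.2.2.1 - μm * inner ℝ ξ z.2.1) / (z.1 - μm)) ^ 2 +
      μm * (μp - z.1) * (d - (μp * inner ℝ ξ z.2.1 - inner ℝ ξ z.2.2.1) / (μp - z.1)) ^ 2) /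
        (μp - μm) := by
  have e1 : z.1 - μm ≠ 0 := (sub_pos.2 h1).ne'
  have e2 : μp - z.1 ≠ 0 := (sub_pos.2 h2).ne'
  have e3 : μp - μm ≠ 0 := (sub_pos.2 (h1.trans h2)).ne'
  rw [quadForm_Mmat, affineMinorant]
  field_simp
  ring

lemma div_sq_lt_iff {E : Type*} [NormedAddCommGroup E] {n : ℕ} (hn : 0 < n) {κ s e : ℝ}
    (hκ : 0 ≤ κ) (hs : 0 < s) (he : 0 ≤ e) (v : E) :
    κ / n * ‖v‖ ^ 2 / s ^ 2 < e ↔ √κ * ‖v‖ < √(n * e) * s := by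
  have hn' : (0 : ℝ) < n := Nat.cast_pos.2 hn
  have h : √κ * ‖v‖ < √(n * e) * s ↔ (√κ * ‖v‖) ^ 2 < (√(n * e) * s) ^ 2 :=
    (pow_lt_pow_iff_left₀ (by positivity) (by positivity) two_ne_zero).symm
  rw [h, mul_pow, mul_pow, Real.sq_sqrt hκ, Real.sq_sqrt (by positivity),
    div_lt_iff₀ (by positivity), div_mul_eq_mul_div, div_lt_iff₀ hn']
  ring_nf

lemma mem_Uset_iff {n : ℕ} (hn : 0 < n) {μm μp e : ℝ} (hμm : 0 < μm) (he : 0 < e) (z : Zsp n) :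
    z ∈ Uset n μm μp e ↔ μm < z.1 ∧ z.1 < μp ∧
      √μp * ‖z.2.2.1 - μm • z.2.1‖ < √(n * e) * (z.1 - μm) ∧
      √μm * ‖z.2.2.1 - μp • z.2.1‖ < √(n * e) * (μp - z.1) ∧ QZ μm μp z < e := by
  constructor
  · rintro ⟨⟨h1, h2⟩, h3, h4, h5⟩
    refine ⟨h1, h2, ?_, ?_, h5⟩
    · exact (div_sq_lt_iff hn (by linarith) (sub_pos.2 h1) he.le _).1 h3
    · refine (div_sq_lt_iff hn hμm.le (sub_pos.2 h2) he.le _).1 ?_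
      rwa [TmZ, Tm, ← neg_sq (z.1 - μp), neg_sub] at h4
  · rintro ⟨h1, h2, h3, h4, h5⟩
    refine ⟨⟨h1, h2⟩, ?_, ?_, h5⟩
    · exact (div_sq_lt_iff hn (by linarith) (sub_pos.2 h1) he.le _).2 h3
    · rw [TmZ, Tm, ← neg_sq (z.1 - μp), neg_sub]
      exact (div_sq_lt_iff hn hμm.le (sub_pos.2 h2) he.le _).2 h4

lemma midpoint_mem_Uset {n : ℕ} (hn : 0 < n) {μm μp e : ℝ} (hμm : 0 < μm) (he : 0 < e)
    {x y : Zsp n} (hx : x ∈ Uset n μm μp e) (hy : y ∈ closedHull n μm μp e) :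
    (1 / 2 : ℝ) • x + (1 / 2 : ℝ) • y ∈ Uset n μm μp e := by
  rw [mem_Uset_iff hn hμm he] at hx ⊢
  obtain ⟨hx1, hx2, hx3, hx4, hx5⟩ := hx
  obtain ⟨hy1, hy2, hy3, hy4, hy5⟩ := hy
  have hhalf : (0 : ℝ) ≤ 1 / 2 := by norm_num
  have h1 : μm < ((1 / 2 : ℝ) • x + (1 / 2 : ℝ) • y).1 := by
    simp only [Prod.fst_add, Prod.smul_fst, smul_eq_mul]
    linarith
  have h2 : ((1 / 2 : ℝ) • x + (1 / 2 : ℝ) • y).1 < μp := by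
    simp only [Prod.fst_add, Prod.smul_fst, smul_eq_mul]
    linarith
  refine ⟨h1, h2, ?_, ?_, ?_⟩
  · refine (mul_le_mul_of_nonneg_left
      (norm_convex_comb_sub_le μm x.2.2.1 x.2.1 y.2.2.1 y.2.1 hhalf hhalf)
      (Real.sqrt_nonneg μp)).trans_lt ?_
    simp only [Prod.fst_add, Prod.smul_fst, smul_eq_mul]
    linarith
  · refine (mul_le_mul_of_nonneg_left
      (norm_convex_comb_sub_le μp x.2.2.1 x.2.1 y.2.2.1 y.2.1 hhalf hhalf)
      (Real.sqrt_nonneg μm)).trans_lt ?_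
    simp only [Prod.fst_add, Prod.smul_fst, smul_eq_mul]
    linarith
  · refine (lamMax_le hn _ (c := 1 / 2 * QZ μm μp x + 1 / 2 * e) fun ξ hξ => ?_).trans_lt
      (by linarith)
    set z := (1 / 2 : ℝ) • x + (1 / 2 : ℝ) • y with hz
    have hmain := quadForm_Mmat_eq_affineMinorant_add z ξ
      ((inner ℝ ξ z.2.2.1 - μm * inner ℝ ξ z.2.1) / (z.1 - μm))
      ((μp * inner ℝ ξ z.2.1 - inner ℝ ξ z.2.2.1) / (μp - z.1)) h1 h2
    generalize (inner ℝ ξ z.2.2.1 - μm * inner ℝ ξ z.2.1) / (z.1 - μm) = c at hmain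
    generalize (μp * inner ℝ ξ z.2.1 - inner ℝ ξ z.2.2.1) / (μp - z.1) = d at hmain
    have hx6 : affineMinorant μm μp c d ξ x ≤ QZ μm μp x := by
      refine le_trans ?_ (quadForm_le_lamMax _ hξ)
      rw [quadForm_Mmat_eq_affineMinorant_add x ξ c d hx1 hx2, le_add_iff_nonneg_right]
      have p1 := sub_pos.2 hx1
      have p2 := sub_pos.2 hx2
      have p3 := sub_pos.2 (hx1.trans hx2)
      have p4 : 0 < μp := by linarith
      positivity
    rw [hmain, hz, affineMinorant_convex_comb _ _ _ _ _ _ _ (by norm_num)]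
    have := hy5 ξ c d hξ
    simp only [sub_self, ne_eq, OfNat.ofNat_ne_zero, not_false_eq_true, zero_pow, mul_zero,
      add_zero, zero_div]
    linarith

/-- The coordinates of `π(z)` as a linear map into a Euclidean space. -/
def coordMap (n : ℕ) : (ℝ × En n × En n × ↥(S0 n)) →ₗ[ℝ]
    EuclideanSpace ℝ (Unit ⊕ Fin n ⊕ Fin n ⊕ Fin n × Fin n) where
  toFun p := WithLp.toLp 2 (Sum.elim (fun _ => p.1) (Sum.elim (fun i => p.2.1 i)
    (Sum.elim (fun i => p.2.2.1 i)
      (fun ij => (p.2.2.2 : Matrix (Fin n) (Fin n) ℝ) ij.1 ij.2))))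
  map_add' p q := by ext (_ | _ | _ | _) <;> simp
  map_smul' c p := by ext (_ | _ | _ | _) <;> simp

lemma pnormE_eq_norm_coordMap {n : ℕ} (p : ℝ × En n × En n × ↥(S0 n)) :
    pnormE p = ‖coordMap n p‖ := by
  rw [EuclideanSpace.norm_eq, pnormE]
  simp [coordMap, EuclideanSpace.real_norm_sq_eq, Fintype.sum_prod_type, add_assoc]

lemma pnormE_nonneg {n : ℕ} (p : ℝ × En n × En n × ↥(S0 n)) : 0 ≤ pnormE p :=
  Real.sqrt_nonneg _

lemma pnormE_smul {n : ℕ} {c : ℝ} (hc : 0 ≤ c) (p : ℝ × En n × En n × ↥(S0 n)) :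
    pnormE (c • p) = c * pnormE p := by
  rw [pnormE_eq_norm_coordMap, pnormE_eq_norm_coordMap, map_smul, norm_smul,
    Real.norm_of_nonneg hc]

lemma pnormE_sum_le {n : ℕ} {ι : Type*} (s : Finset ι) (f : ι → ℝ × En n × En n × ↥(S0 n)) :
    pnormE (∑ x ∈ s, f x) ≤ ∑ x ∈ s, pnormE (f x) := by
  simp only [pnormE_eq_norm_coordMap, map_sum]
  exact norm_sum_le _ _

lemma abs_fst_le_pnormE {n : ℕ} (p : ℝ × En n × En n × ↥(S0 n)) : |p.1| ≤ pnormE p := by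
  refine Real.abs_le_sqrt ?_
  have h : 0 ≤ ∑ i, ∑ j, ((p.2.2.2 : Matrix (Fin n) (Fin n) ℝ) i j) ^ 2 :=
    Finset.sum_nonneg fun i _ => Finset.sum_nonneg fun j _ => sq_nonneg _
  nlinarith [sq_nonneg ‖p.2.1‖, sq_nonneg ‖p.2.2.1‖]

lemma exists_ne_zero_sum_mul_eq_zero {n : ℕ} (hn : 2 ≤ n) (w : Fin n → ℝ) :
    ∃ ξ : Fin n → ℝ, ξ ≠ 0 ∧ ∑ j, w j * ξ j = 0 := by
  let f : (Fin n → ℝ) →ₗ[ℝ] ℝ := ∑ j, w j • LinearMap.proj j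
  have hf : LinearMap.ker f ≠ ⊥ := LinearMap.ker_ne_bot_of_finrank_lt (by simp; omega)
  obtain ⟨ξ, hξ, h0⟩ := Submodule.exists_mem_ne_zero_of_ne_bot hf
  refine ⟨ξ, h0, ?_⟩
  simpa [f, LinearMap.mem_ker] using hξ

/-- Differences of elements of `Kset` with equal pressure lie in the wave cone. -/
lemma smul_sub_mem_Lambda {n : ℕ} (hn : 2 ≤ n) {μm μp e : ℝ} (hμm : 0 < μm) (hμ : μm < μp)
    {k k' : Zsp n} (hk : k ∈ Kset n μm μp e)
    (hk' : k' ∈ Kset n μm μp e) (hq : k.2.2.2.2 = k'.2.2.2.2) (hne : pz k - pz k' ≠ 0) {c : ℝ}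
    (hc : c ≠ 0) : c • (k - k') ∈ Lambda n := by
  obtain ⟨h1, hm, hσ⟩ := hk
  obtain ⟨h1', hm', hσ'⟩ := hk'
  have hσσ : (k.2.2.2.1 : Matrix (Fin n) (Fin n) ℝ) - k'.2.2.2.1 =
      k.1 • op k.2.1 k.2.1 - k'.1 • op k'.2.1 k'.2.1 := by
    rw [← hσ'] at hσ
    rw [sub_eq_sub_iff_add_eq_add] at hσ ⊢
    rw [add_comm, ← hσ]
  constructor
  · rintro ⟨h2, h3⟩
    simp only [Prod.smul_fst, Prod.smul_snd, Prod.fst_sub, Prod.snd_sub, smul_eq_zero, hc,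
      false_or, sub_eq_zero, smul_eq_mul, mul_eq_zero] at h2 h3
    apply hne
    have hpos : k'.1 ≠ 0 := by rcases h1' with h | h <;> rw [h] <;> linarith
    have hw : k.2.1 = k'.2.1 := by
      rw [hm, hm', h2] at h3
      exact smul_right_injective _ hpos h3
    have hs : k.2.2.2.1 = k'.2.2.2.1 := by
      rw [h2, hw, sub_self, sub_eq_zero] at hσσ
      exact Subtype.ext hσσ
    rw [sub_eq_zero, pz, pz, h2, hw, h3, hs]
  · obtain ⟨ξ, h0, hξ⟩ := exists_ne_zero_sum_mul_eq_zero hn fun j => k.2.1 j - k'.2.1 j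
    have ht : ∑ j, k.2.1 j * ξ j = ∑ j, k'.2.1 j * ξ j := by
      simp only [sub_mul, Finset.sum_sub_distrib] at hξ
      linarith
    refine ⟨ξ, -∑ j, k'.2.1 j * ξ j, fun h => h0 h.1, ?_, ?_, ?_⟩
    · ext i
      simp only [Prod.smul_snd, Prod.smul_fst, Prod.snd_sub, Prod.fst_sub, hq, sub_self,
        smul_zero, zero_smul, add_zero, Submodule.coe_smul, Submodule.coe_sub, hσσ, hm, hm']
      have e1 : ∀ (u : En n), (op u u).mulVec ξ i = u i * ∑ j, u j * ξ j := fun u => by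
        simp [op, Matrix.mulVec, dotProduct, Finset.mul_sum, mul_assoc]
      simp only [Matrix.smul_mulVec, Matrix.sub_mulVec, Pi.add_apply, Pi.smul_apply, Pi.sub_apply,
        e1, ht, smul_eq_mul, PiLp.smul_apply, PiLp.sub_apply, Pi.zero_apply]
      ring
    · have e2 : ∀ (a : ℝ) (u : En n), ∑ j, a * u j * ξ j = a * ∑ j, u j * ξ j := fun a u => by
        simp only [Finset.mul_sum, mul_assoc]
      simp only [Prod.smul_snd, Prod.smul_fst, Prod.snd_sub, Prod.fst_sub, hm, hm',
        smul_eq_mul, PiLp.smul_apply, PiLp.sub_apply, mul_assoc, sub_mul, ← Finset.mul_sum,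
        Finset.sum_sub_distrib, ht]
      ring
    · simp only [Prod.smul_snd, Prod.smul_fst, Prod.snd_sub, Prod.fst_sub,
        smul_eq_mul, PiLp.smul_apply, PiLp.sub_apply, mul_assoc, ← Finset.mul_sum, hξ, mul_zero]

lemma exists_mem_Kset {n : ℕ} {μm μp e κ : ℝ} (hκ : κ = μm ∨ κ = μp) (q : ℝ) {w : En n}
    (hw : κ * ‖w‖ ^ 2 = n * e) :
    ∃ k ∈ Kset n μm μp e, k.1 = κ ∧ k.2.1 = w ∧ k.2.2.1 = κ • w ∧
      (k.2.2.2.1 : Matrix (Fin n) (Fin n) ℝ) = κ • op w w - e • 1 ∧ k.2.2.2.2 = q := by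
  refine ⟨(κ, w, κ • w, ⟨κ • op w w - e • 1, ?_, ?_⟩, q), ⟨hκ, rfl, sub_sub_cancel _ _⟩,
    rfl, rfl, rfl, rfl, rfl⟩
  · simp [Matrix.IsSymm, op_transpose]
  · rw [Matrix.trace_sub, Matrix.trace_smul, Matrix.trace_smul, trace_op,
      real_inner_self_eq_norm_sq, smul_eq_mul, hw]
    simp [mul_comm]

lemma sum_nested_smul {n : ℕ} {E : Type*} [AddCommGroup E] [Module ℝ E] (α : Bool → ℝ)
    (p : Fin n → ℝ) (θ : Bool → Fin n → Bool → ℝ) (g : Bool × Fin n × Bool → E) :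
    ∑ x : Bool × Fin n × Bool, (α x.1 * p x.2.1 * θ x.1 x.2.1 x.2.2) • g x =
      ∑ s, α s • ∑ i, p i • ∑ b, θ s i b • g (s, i, b) := by
  simp only [Fintype.sum_prod_type, Finset.smul_sum, smul_smul, mul_assoc]

lemma exists_Kset_decomposition {n : ℕ} (hn : 0 < n) {μm μp e : ℝ} (hμm : 0 < μm)
    (hμ : μm < μp) {z : Zsp n} (hz : z ∈ Uset n μm μp e) :
    ∃ (l : Bool × Fin n × Bool → ℝ) (k : Bool × Fin n × Bool → Zsp n), (∀ x, 0 ≤ l x) ∧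
      ∑ x, l x = 1 ∧ (∀ x, k x ∈ Kset n μm μp e) ∧ (∀ x, (k x).2.2.2.2 = z.2.2.2.2) ∧
      ∑ x, l x • k x = z := by
  obtain ⟨μ, w, m, σ, q⟩ := z
  obtain ⟨⟨h1, h2⟩, h3, h4, h5⟩ := hz
  simp only [TpZ, TmZ, QZ] at h1 h2 h3 h4 h5
  have hμp : 0 < μp := hμm.trans hμ
  have hn' : (0 : ℝ) < n := Nat.cast_pos.2 hn
  have e1 : μ - μm ≠ 0 := (sub_pos.2 h1).ne'
  have e2 : μp - μ ≠ 0 := (sub_pos.2 h2).ne'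
  have hs := sub_pos.2 hμ
  have e3 : μp - μm ≠ 0 := hs.ne'
  let κ : Bool → ℝ := fun s => if s then μp else μm
  let v : Bool → En n := fun s =>
    if s then (μ - μm)⁻¹ • (m - μm • w) else (μp - μ)⁻¹ • (μp • w - m)
  let α : Bool → ℝ := fun s => if s then (μ - μm) / (μp - μm) else (μp - μ) / (μp - μm)
  have hκ : ∀ s, 0 < κ s := by rintro (_ | _) <;> simp [κ, hμm, hμp]
  have hα : ∀ s, 0 < α s := by
    rintro (_ | _)
    · exact div_pos (sub_pos.2 h2) hs
    · exact div_pos (sub_pos.2 h1) hs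
  have hα1 : ∑ s, α s = 1 := by simp [α]; field_simp; ring
  have hακ : ∑ s, α s * κ s = μ := by simp [α, κ]; field_simp; ring
  have hαv : ∑ s, α s • v s = w := by
    ext i; simp [α, v]; field_simp; ring
  have hακv : ∑ s, α s • κ s • v s = m := by
    ext i; simp [α, v, κ]; field_simp; ring
  have hv : ∀ s, ‖v s‖ ^ 2 < n * e / κ s := by
    have hT : ∀ (κ s : ℝ) (u : En n), 0 < κ → κ / n * ‖u‖ ^ 2 / s ^ 2 < e →
        ‖s⁻¹ • u‖ ^ 2 < n * e / κ := fun κ s u hκ h => by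
      rw [norm_smul, mul_pow, norm_inv, inv_pow, Real.norm_eq_abs, sq_abs, lt_div_iff₀ hκ]
      have := mul_lt_mul_of_pos_left h hn'
      refine lt_of_eq_of_lt ?_ this
      field_simp
    rintro (_ | _)
    · refine hT _ _ _ hμm ?_
      rwa [Tm, ← neg_sq (μ - μp), neg_sub, ← norm_neg, neg_sub] at h4
    · exact hT _ _ _ hμp h3
  let A : Matrix (Fin n) (Fin n) ℝ :=
    e • 1 - Mmat μm μp μ w m (σ : Matrix (Fin n) (Fin n) ℝ)
  have hMv : Mmat μm μp μ w m (σ : Matrix (Fin n) (Fin n) ℝ) =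
      ∑ s, α s • κ s • op (v s) (v s) - (σ : Matrix (Fin n) (Fin n) ℝ) := by
    ext i j
    simp [Mmat, op, α, κ, v]
    field_simp
    ring
  have hAsymm : A.IsSymm := by
    have hσ : (σ : Matrix (Fin n) (Fin n) ℝ)ᵀ = σ := σ.2.1
    simp only [A, hMv, Matrix.IsSymm, Matrix.transpose_sub, Matrix.transpose_smul,
      Matrix.transpose_one, hσ, Matrix.transpose_sum, op_transpose]
  have hApos : ∀ ξ : En n, ‖ξ‖ = 1 → 0 ≤ quadForm A ξ := fun ξ hξ => by
    have := quadForm_le_lamMax (Mmat μm μp μ w m (σ : Matrix (Fin n) (Fin n) ℝ)) hξ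
    rw [quadForm_sub, quadForm_smul, quadForm_one, hξ]
    linarith
  obtain ⟨c, a, hc, ha, hcA, hAc⟩ := exists_rank_one_decomposition A hAsymm hApos
  have hT : A.trace = ∑ s, α s * (κ s * (n * e / κ s - ‖v s‖ ^ 2)) := by
    have hσ : (σ : Matrix (Fin n) (Fin n) ℝ).trace = 0 := σ.2.2
    have hne : e * n = ∑ s, α s * (n * e) := by rw [← Finset.sum_mul, hα1, one_mul, mul_comm]
    simp only [A, hMv, Matrix.trace_sub, Matrix.trace_smul, Matrix.trace_one, hσ,
      Matrix.trace_sum, trace_op, real_inner_self_eq_norm_sq, smul_eq_mul, Fintype.card_fin,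
      sub_zero]
    rw [hne, ← Finset.sum_sub_distrib]
    refine Finset.sum_congr rfl fun s _ => ?_
    have := (hκ s).ne'
    field_simp
  have hTpos : 0 < A.trace := by
    rw [hT]
    exact Finset.sum_pos (fun s _ => mul_pos (hα s) (mul_pos (hκ s) (sub_pos.2 (hv s))))
      Finset.univ_nonempty
  set T := A.trace with hTdef
  have hp1 : ∑ i, c i / T = 1 := by rw [← Finset.sum_div, hcA, div_self hTpos.ne']
  choose y θ hθ hy hθ1 hθy hθop using fun (s : Bool) (i : Fin n) =>
    exists_two_point_splitting (v s) (a i) (ha i) (hv s)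
  have hy' : ∀ x : Bool × Fin n × Bool, κ x.1 * ‖y x.1 x.2.1 x.2.2‖ ^ 2 = n * e := fun x => by
    rw [hy, mul_div_cancel₀ _ (hκ x.1).ne']
  have hκ' : ∀ s, κ s = μm ∨ κ s = μp := by rintro (_ | _) <;> simp [κ]
  choose k hk hk1 hk2 hk3 hk4 hk5 using fun x => exists_mem_Kset (hκ' x.1) q (hy' x)
  have hsum1 : ∑ x : Bool × Fin n × Bool, α x.1 * (c x.2.1 / T) * θ x.1 x.2.1 x.2.2 = 1 := by
    have := sum_nested_smul α (fun i => c i / T) θ (fun _ => (1 : ℝ))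
    simp only [smul_eq_mul, mul_one, hθ1, hp1, hα1] at this
    exact this
  refine ⟨fun x => α x.1 * (c x.2.1 / T) * θ x.1 x.2.1 x.2.2, k, fun x => ?_, hsum1, hk, hk5, ?_⟩
  · exact mul_nonneg (mul_nonneg (hα _).le (div_nonneg (hc _) hTpos.le)) (hθ _ _ _)
  · refine Prod.ext ?_ (Prod.ext ?_ (Prod.ext ?_ (Prod.ext (Subtype.ext ?_) ?_)))
    · simp only [Prod.fst_sum, Prod.smul_fst, hk1]
      rw [sum_nested_smul α (fun i => c i / T) θ]
      simp only [← Finset.sum_smul, hθ1, hp1, one_smul]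
      exact hακ
    · simp only [Prod.fst_sum, Prod.snd_sum, Prod.smul_fst, Prod.smul_snd, hk2]
      rw [sum_nested_smul α (fun i => c i / T) θ]
      simp only [hθy, ← Finset.sum_smul, hp1, one_smul]
      exact hαv
    · simp only [Prod.fst_sum, Prod.snd_sum, Prod.smul_fst, Prod.smul_snd, hk3]
      rw [sum_nested_smul α (fun i => c i / T) θ]
      simp only [smul_comm _ (κ _), ← Finset.smul_sum, hθy, ← Finset.sum_smul, hp1, one_smul]
      rw [← hακv]
      exact Finset.sum_congr rfl fun s _ => smul_comm _ _ _
    · simp only [Prod.fst_sum, Prod.snd_sum, Prod.smul_fst, Prod.smul_snd,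
        Submodule.coe_sum, Submodule.coe_smul, hk4]
      rw [sum_nested_smul α (fun i => c i / T) θ]
      have hin : ∀ s, ∑ i, (c i / T) • ∑ b, θ s i b •
          (κ s • op (y s i b) (y s i b) - e • (1 : Matrix (Fin n) (Fin n) ℝ)) =
          κ s • op (v s) (v s) + ((κ s * (n * e / κ s - ‖v s‖ ^ 2)) / T) • A - e • 1 := by
        intro s
        simp only [smul_sub, Finset.sum_sub_distrib, ← Finset.sum_smul, hθ1, one_smul, hp1,
          smul_comm _ (κ s), ← Finset.smul_sum, hθop, smul_add, Finset.sum_add_distrib]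
        congr 2
        rw [hAc]
        simp only [Finset.smul_sum, smul_smul]
        refine Finset.sum_congr rfl fun i _ => ?_
        congr 1
        ring
      simp only [hin]
      simp only [smul_sub, smul_add, Finset.sum_sub_distrib, Finset.sum_add_distrib,
        ← Finset.sum_smul, hα1, one_smul, smul_smul (α _) (_ / T), ← mul_div_assoc,
        ← Finset.sum_div, ← hT, div_self hTpos.ne']
      simp only [A, hMv]
      abel
    · simp only [Prod.snd_sum, Prod.smul_snd, hk5]
      rw [← Finset.sum_smul, hsum1, one_smul]

lemma add_smul_sub_mem_convexHull {E ι : Type*} [AddCommGroup E] [Module ℝ E] [Fintype ι]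
    {s : Set E} {l : ι → ℝ} {k : ι → E} (hl : ∀ x, 0 ≤ l x) (hl1 : ∑ x, l x = 1)
    (hk : ∀ x, k x ∈ s) {i j : ι} {t : ℝ} (hti : |t| ≤ l i) (htj : |t| ≤ l j) :
    ∑ x, l x • k x + t • (k i - k j) ∈ convexHull ℝ s := by
  classical
  have h : ∑ x, l x • k x + t • (k i - k j) =
      ∑ x, (l x + t * ((if x = i then 1 else 0) - if x = j then 1 else 0)) • k x := by
    simp only [add_smul, mul_smul, sub_smul, Finset.sum_add_distrib, ← Finset.smul_sum,
      Finset.sum_sub_distrib, ite_smul, one_smul, zero_smul, Finset.sum_ite_eq', Finset.mem_univ,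
      if_true]
  rw [h]
  refine (convex_convexHull ℝ s).sum_mem (fun x _ => ?_) ?_
    fun x _ => subset_convexHull ℝ s (hk x)
  · have h0 := hl x
    have h1 := abs_le.1 hti
    have h2 := abs_le.1 htj
    split_ifs with hi hj hj
    · simpa using h0
    · subst hi; linarith
    · subst hj; linarith
    · simpa using h0
  · simp [Finset.sum_add_distrib, ← Finset.mul_sum, hl1]

/-- With `N = dim Z = 2n + 1 + n(n+1)/2`: every `z ∈ U` admits a wave-cone
direction `z̄` with `[z − z̄, z + z̄] ⊆ U` and `|π(z̄)| ≥ (1/(2N))·dist(π(z), π(K))`. -/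
theorem long_segments_in_U (n : ℕ) (hn : 2 ≤ n) (μm μp : ℝ) (hμm : 0 < μm)
    (hμ : μm < μp) (e : ℝ) (he : 0 < e) (z : Zsp n) (hz : z ∈ Uset n μm μp e) :
    ∃ zb ∈ Lambda n,
      (∀ t ∈ Set.Icc (-1 : ℝ) 1, z + t • zb ∈ Uset n μm μp e) ∧
      (1 / (2 * ((2 * n + 1 + n * (n + 1) / 2 : ℕ) : ℝ))) *
          sInf {d : ℝ | ∃ k ∈ Kset n μm μp e, d = pnormE (pz z - pz k)} ≤ pnormE (pz zb) := by
  have hn0 : 0 < n := by omega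
  obtain ⟨l, k, hl, hl1, hk, hkq, hkz⟩ := exists_Kset_decomposition hn0 hμm hμ hz
  have : Nonempty (Fin n) := ⟨⟨0, hn0⟩⟩
  obtain ⟨x₀, hx₀⟩ := Finite.exists_max l
  obtain ⟨x₁, hx₁⟩ := Finite.exists_max fun x => l x * pnormE (pz (k x) - pz (k x₀))
  set d := pnormE (pz (k x₁) - pz (k x₀)) with hd
  set δ := pnormE (pz z - pz (k x₀)) with hδ
  have hsum : pz z - pz (k x₀) = ∑ x, l x • (pz (k x) - pz (k x₀)) := by
    simp only [smul_sub, Finset.sum_sub_distrib, ← Finset.sum_smul, hl1, one_smul]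
    rw [← hkz]
    congr 1
    simp [pz, Prod.ext_iff, Prod.fst_sum, Prod.snd_sum]
  have hδle : δ ≤ 4 * n * (l x₁ * d) := by
    rw [hδ, hsum]
    refine (pnormE_sum_le _ _).trans ?_
    refine (Finset.sum_le_card_nsmul _ _ (l x₁ * d) fun x _ => ?_).trans_eq ?_
    · rw [pnormE_smul (hl x)]
      exact hx₁ x
    · simp only [Finset.card_univ, Fintype.card_prod, Fintype.card_bool, Fintype.card_fin,
        nsmul_eq_mul]
      push_cast
      ring
  have hδpos : 0 < δ := by
    refine lt_of_lt_of_le (abs_pos.2 ?_) (abs_fst_le_pnormE _)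
    rintro h
    have h' : z.1 - (k x₀).1 = 0 := h
    rcases (hk x₀).1 with h2 | h2
    · linarith [hz.1.1]
    · linarith [hz.1.2]
  have hld : 0 < l x₁ * d := by
    by_contra! h
    have hn' : (0 : ℝ) ≤ 4 * n := by positivity
    linarith [mul_nonpos_of_nonneg_of_nonpos hn' h]
  have hlpos : 0 < l x₁ := (hl x₁).lt_of_ne fun h => by simp [← h] at hld
  have hne : pz (k x₁) - pz (k x₀) ≠ 0 := fun h => by
    rw [hd, h, pnormE_eq_norm_coordMap] at hld
    simp at hld
  refine ⟨(l x₁ / 2) • (k x₁ - k x₀), smul_sub_mem_Lambda hn hμm hμ (hk _) (hk _)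
    ((hkq _).trans (hkq _).symm) hne (by positivity), fun t ht => ?_, ?_⟩
  · have htl : |t * l x₁| ≤ l x₁ := by
      rw [abs_mul, abs_of_pos hlpos]
      exact mul_le_of_le_one_left hlpos.le (abs_le.2 ht)
    have hy := convexHull_min (Kset_subset_closedHull hμm hμ) (convex_closedHull n μm μp e)
      (add_smul_sub_mem_convexHull hl hl1 hk htl (htl.trans (hx₀ x₁)))
    rw [hkz] at hy
    have := midpoint_mem_Uset hn0 hμm he hz hy
    convert this using 1
    module
  · have hpz : pz ((l x₁ / 2) • (k x₁ - k x₀)) = (l x₁ / 2) • (pz (k x₁) - pz (k x₀)) := rfl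
    rw [hpz, pnormE_smul (by positivity), ← hd]
    have hinf : sInf {d : ℝ | ∃ k ∈ Kset n μm μp e, d = pnormE (pz z - pz k)} ≤ δ := by
      refine csInf_le ⟨0, ?_⟩ ⟨k x₀, hk x₀, rfl⟩
      rintro r ⟨k', -, rfl⟩
      exact pnormE_nonneg _
    have hN : 4 * n ≤ 2 * n + 1 + n * (n + 1) / 2 := by
      have : 2 * n - 1 ≤ n * (n + 1) / 2 := by
        rw [Nat.le_div_iff_mul_le two_pos]
        obtain ⟨r, rfl⟩ := Nat.exists_eq_add_of_le hn
        have : 2 * (2 + r) - 1 = 2 * r + 3 := by omega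
        rw [this]
        nlinarith [Nat.le_mul_self r]
      omega
    have hN' : (4 * n : ℝ) ≤ ((2 * n + 1 + n * (n + 1) / 2 : ℕ) : ℝ) := by exact_mod_cast hN
    generalize ((2 * n + 1 + n * (n + 1) / 2 : ℕ) : ℝ) = N at hN'
    have hNpos : 0 < N := lt_of_lt_of_le (by positivity) hN'
    rw [one_div_mul_eq_div, div_le_iff₀ (by positivity)]
    calc _ ≤ δ := hinf
      _ ≤ 4 * n * (l x₁ * d) := hδle
      _ ≤ N * (l x₁ * d) := by gcongr
      _ = l x₁ / 2 * d * (2 * N) := by ring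
end
end

section
/- Let d ≥ 1, let 𝒰 ⊆ ℝ^d be open, and let E : 𝒰 → (0, ∞) be continuous and bounded. Then for every y ∈ 𝒰 the set π(K(E(y))) is a nonempty compact subset of ℝ × ℝⁿ × ℝⁿ × S₀, the map y ↦ π(K(E(y))) is continuous with respect to the Hausdorff distance on nonempty compact sets, and the union ⋃_{y ∈ 𝒰} π(K(E(y))) is bounded. -/
noncomputable section

open Matrix

attribute [local instance] Matrix.frobeniusSeminormedAddCommGroup
attribute [local instance] Matrix.frobeniusNormedAddCommGroup

section Scaling

attribute [local instance] Matrix.frobeniusNormedSpace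

/-- The scaling `(μ, w, m, σ) ↦ (μ, √e w, √e m, e σ)`, which maps `π(K(1))` onto `π(K(e))`. -/
def energyScale {n : ℕ} (e : ℝ) (p : ℝ × En n × En n × ↥(S0 n)) : ℝ × En n × En n × ↥(S0 n) :=
  (p.1, √e • p.2.1, √e • p.2.2.1, e • p.2.2.2)

theorem op_smul_smul {n : ℕ} (a : ℝ) (w : En n) : op (a • w) (a • w) = a ^ 2 • op w w := by
  ext i j
  simp only [op, PiLp.smul_apply, smul_eq_mul, Matrix.smul_apply]
  ring

theorem trace_op_self {n : ℕ} (w : En n) : (op w w).trace = ‖w‖ ^ 2 := by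
  rw [EuclideanSpace.real_norm_sq_eq]
  simp [Matrix.trace, op, sq]

theorem continuous_op_self {n : ℕ} : Continuous fun w : En n => op w w := by
  refine continuous_pi fun i => continuous_pi fun j => ?_
  simp only [op]
  fun_prop

theorem energyScale_mem {n : ℕ} {μm μp a e : ℝ} (he : 0 ≤ e) {p : ℝ × En n × En n × ↥(S0 n)}
    (hp : p ∈ pz '' Kset n μm μp a) : energyScale e p ∈ pz '' Kset n μm μp (e * a) := by
  obtain ⟨z, ⟨hz, hm, hσ⟩, rfl⟩ := hp
  refine ⟨(z.1, √e • z.2.1, √e • z.2.2.1, e • z.2.2.2.1, 0), ⟨hz, ?_, ?_⟩, rfl⟩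
  · change √e • z.2.2.1 = z.1 • √e • z.2.1
    rw [hm, smul_comm]
  · simp only [op_smul_smul, Real.sq_sqrt he, Submodule.coe_smul]
    rw [smul_comm, ← smul_sub, hσ, smul_smul]

theorem energyScale_energyScale_inv {n : ℕ} {e : ℝ} (he : 0 < e)
    (p : ℝ × En n × En n × ↥(S0 n)) : energyScale e (energyScale e⁻¹ p) = p := by
  have h : √e * √e⁻¹ = 1 := by rw [← Real.sqrt_mul he.le, mul_inv_cancel₀ he.ne', Real.sqrt_one]
  simp only [energyScale, smul_smul, h, mul_inv_cancel₀ he.ne', one_smul]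

theorem image_Kset_eq_energyScale {n : ℕ} {μm μp e : ℝ} (he : 0 < e) :
    pz '' Kset n μm μp e = energyScale e '' (pz '' Kset n μm μp 1) := by
  apply Set.Subset.antisymm
  · intro p hp
    refine ⟨energyScale e⁻¹ p, ?_, energyScale_energyScale_inv he p⟩
    simpa [he.ne'] using energyScale_mem (inv_nonneg.2 he.le) hp
  · rintro _ ⟨p, hp, rfl⟩
    simpa using energyScale_mem he.le hp

theorem continuous_energyScale {n : ℕ} (e : ℝ) : Continuous (energyScale (n := n) e) := by
  unfold energyScale
  fun_prop

theorem norm_energyScale_le {n : ℕ} {e : ℝ} (he : 0 ≤ e) (p : ℝ × En n × En n × ↥(S0 n)) :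
    ‖energyScale e p‖ ≤ (1 + √e + e) * ‖p‖ := by
  have hs := Real.sqrt_nonneg e
  have h1 : ‖p.1‖ ≤ ‖p‖ := norm_fst_le p
  have h2 : ‖p.2.1‖ ≤ ‖p‖ := (norm_fst_le p.2).trans (norm_snd_le p)
  have h3 : ‖p.2.2.1‖ ≤ ‖p‖ := (norm_fst_le p.2.2).trans ((norm_snd_le p.2).trans (norm_snd_le p))
  have h4 : ‖p.2.2.2‖ ≤ ‖p‖ := (norm_snd_le p.2.2).trans ((norm_snd_le p.2).trans (norm_snd_le p))
  have hp := norm_nonneg p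
  have hsp := mul_nonneg hs hp
  have hep := mul_nonneg he hp
  simp only [energyScale, Prod.norm_mk, sup_le_iff, norm_smul, Real.norm_of_nonneg hs,
    Real.norm_of_nonneg he]
  refine ⟨?_, ?_, ?_, ?_⟩ <;>
    nlinarith [mul_le_mul_of_nonneg_left h2 hs, mul_le_mul_of_nonneg_left h3 hs,
      mul_le_mul_of_nonneg_left h4 he]

theorem dist_energyScale_le {n : ℕ} (e e' : ℝ) (p : ℝ × En n × En n × ↥(S0 n)) :
    dist (energyScale e p) (energyScale e' p) ≤ (|√e - √e'| + |e - e'|) * ‖p‖ := by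
  have h2 : ‖p.2.1‖ ≤ ‖p‖ := (norm_fst_le p.2).trans (norm_snd_le p)
  have h3 : ‖p.2.2.1‖ ≤ ‖p‖ := (norm_fst_le p.2.2).trans ((norm_snd_le p.2).trans (norm_snd_le p))
  have h4 : ‖p.2.2.2‖ ≤ ‖p‖ := (norm_snd_le p.2.2).trans ((norm_snd_le p.2).trans (norm_snd_le p))
  have hp := norm_nonneg p
  have hs := abs_nonneg (√e - √e')
  have he := abs_nonneg (e - e')
  have hsp := mul_nonneg hs hp
  have hep := mul_nonneg he hp
  have hσ : ‖e • p.2.2.2 - e' • p.2.2.2‖ = |e - e'| * ‖p.2.2.2‖ :=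
    (congrArg norm (sub_smul e e' p.2.2.2)).symm.trans (norm_smul _ _)
  simp only [energyScale, dist_eq_norm, Prod.mk_sub_mk, Prod.norm_mk, sup_le_iff, hσ, ← sub_smul,
    norm_smul, Real.norm_eq_abs, sub_self, abs_zero]
  refine ⟨?_, ?_, ?_, ?_⟩ <;>
    nlinarith [mul_le_mul_of_nonneg_left h2 hs, mul_le_mul_of_nonneg_left h3 hs,
      mul_le_mul_of_nonneg_left h4 he]

theorem sub_smul_one_mem_S0 {n : ℕ} {μ e : ℝ} {w : En n} (h : μ * ‖w‖ ^ 2 = e * n) :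
    μ • op w w - e • (1 : Matrix (Fin n) (Fin n) ℝ) ∈ S0 n := by
  refine ⟨?_, ?_⟩
  · ext i j
    simp [op, Matrix.one_apply, mul_comm, eq_comm]
  · simp [Matrix.trace_sub, trace_op_self, h]

theorem mem_image_Kset_iff {n : ℕ} {μm μp e : ℝ} {p : ℝ × En n × En n × ↥(S0 n)} :
    p ∈ pz '' Kset n μm μp e ↔ (p.1 = μm ∨ p.1 = μp) ∧ p.1 * ‖p.2.1‖ ^ 2 = e * n ∧
      p.2.2.1 = p.1 • p.2.1 ∧
      (p.2.2.2 : Matrix (Fin n) (Fin n) ℝ) =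
        p.1 • op p.2.1 p.2.1 - e • (1 : Matrix (Fin n) (Fin n) ℝ) := by
  constructor
  · rintro ⟨z, ⟨hz, hm, hσ⟩, rfl⟩
    refine ⟨hz, ?_, hm, (sub_eq_iff_eq_add.1 hσ ▸ by simp [pz])⟩
    have := congrArg Matrix.trace hσ
    simpa [pz, Matrix.trace_sub, trace_op_self, z.2.2.2.1.2.2] using this
  · rintro ⟨hz, -, hm, hσ⟩
    exact ⟨(p.1, p.2.1, p.2.2.1, p.2.2.2, 0), ⟨hz, hm, by simp [hσ]⟩, rfl⟩

theorem nonempty_image_Kset {n : ℕ} (hn : 0 < n) {μm : ℝ} (μp : ℝ) (hμm : 0 < μm) {e : ℝ}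
    (he : 0 ≤ e) : (pz '' Kset n μm μp e).Nonempty := by
  let w : En n := EuclideanSpace.single ⟨0, hn⟩ √(e * n / μm)
  have hw : μm * ‖w‖ ^ 2 = e * n := by
    have : 0 ≤ e * n / μm := by positivity
    simp only [w, PiLp.norm_single, Real.norm_eq_abs, sq_abs, Real.sq_sqrt this]
    field_simp
  exact ⟨(μm, w, μm • w, ⟨_, sub_smul_one_mem_S0 hw⟩),
    mem_image_Kset_iff.2 ⟨Or.inl rfl, hw, rfl, rfl⟩⟩

theorem isCompact_image_Kset {n : ℕ} {μm μp : ℝ} (hμm : 0 < μm) (hμp : 0 < μp) (e : ℝ) :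
    IsCompact (pz '' Kset n μm μp e) := by
  let P : Set (ℝ × En n) := {p | p ∈ ({μm, μp} : Set ℝ) ×ˢ Set.univ ∧ p.1 * ‖p.2‖ ^ 2 = e * n}
  have hP : IsCompact P := by
    have hQ : IsCompact (({μm, μp} : Set ℝ) ×ˢ
        Metric.closedBall (0 : En n) (√(e * n / μm) + √(e * n / μp))) :=
      (Set.toFinite _).isCompact.prod (isCompact_closedBall _ _)
    refine hQ.of_isClosed_subset ?_ ?_
    · exact ((Set.toFinite _).isClosed.prod isClosed_univ).inter
        (isClosed_eq (by fun_prop) continuous_const)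
    · rintro ⟨μ, w⟩ ⟨⟨hμ, -⟩, h⟩
      refine ⟨hμ, ?_⟩
      rw [mem_closedBall_zero_iff]
      have hroot : 0 < μ → ‖w‖ = √(e * n / μ) := fun h0 => by
        rw [← h, mul_div_cancel_left₀ _ h0.ne', Real.sqrt_sq (norm_nonneg w)]
      rcases hμ with rfl | rfl
      · exact (hroot hμm).le.trans (le_add_of_nonneg_right (Real.sqrt_nonneg _))
      · exact (hroot hμp).le.trans (le_add_of_nonneg_left (Real.sqrt_nonneg _))
  let F : ℝ × En n → ℝ × En n × En n × Matrix (Fin n) (Fin n) ℝ := fun p =>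
    (p.1, p.2, p.1 • p.2, p.1 • op p.2 p.2 - e • (1 : Matrix (Fin n) (Fin n) ℝ))
  have hF : Continuous F := by
    have := (continuous_op_self (n := n)).comp (continuous_snd (X := ℝ))
    exact continuous_fst.prodMk (continuous_snd.prodMk ((continuous_fst.smul continuous_snd).prodMk
      ((continuous_fst.smul this).sub continuous_const)))
  let ι : ℝ × En n × En n × ↥(S0 n) → ℝ × En n × En n × Matrix (Fin n) (Fin n) ℝ :=
    Prod.map id (Prod.map id (Prod.map id Subtype.val))
  have hι : Topology.IsEmbedding ι :=
    .prodMap .id (.prodMap .id (.prodMap .id .subtypeVal))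
  rw [hι.isCompact_iff]
  convert hP.image hF using 1
  ext q
  constructor
  · rintro ⟨p, hp, rfl⟩
    obtain ⟨hμ, hw, hm, hσ⟩ := mem_image_Kset_iff.1 hp
    exact ⟨(p.1, p.2.1), ⟨⟨hμ, trivial⟩, hw⟩, by simp [F, ι, Prod.map, hm, hσ]⟩
  · rintro ⟨⟨μ, w⟩, ⟨⟨hμ, -⟩, hw⟩, rfl⟩
    exact ⟨(μ, w, μ • w, ⟨_, sub_smul_one_mem_S0 hw⟩),
      mem_image_Kset_iff.2 ⟨hμ, hw, rfl, rfl⟩, rfl⟩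

theorem hausdorffDist_image_Kset_le {n : ℕ} {μm μp R e e' : ℝ} (he : 0 < e) (he' : 0 < e')
    (hR0 : 0 ≤ R) (hR : ∀ p ∈ pz '' Kset n μm μp 1, ‖p‖ ≤ R) :
    Metric.hausdorffDist (pz '' Kset n μm μp e) (pz '' Kset n μm μp e') ≤
      (|√e - √e'| + |e - e'|) * R := by
  rw [image_Kset_eq_energyScale he, image_Kset_eq_energyScale he']
  have key : ∀ p ∈ pz '' Kset n μm μp 1,
      dist (energyScale e p) (energyScale e' p) ≤ (|√e - √e'| + |e - e'|) * R := fun p hp =>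
    (dist_energyScale_le e e' p).trans (mul_le_mul_of_nonneg_left (hR p hp) (by positivity))
  refine Metric.hausdorffDist_le_of_mem_dist (by positivity) ?_ ?_
  · rintro _ ⟨p, hp, rfl⟩
    exact ⟨_, ⟨p, hp, rfl⟩, key p hp⟩
  · rintro _ ⟨p, hp, rfl⟩
    exact ⟨_, ⟨p, hp, rfl⟩, by rw [dist_comm]; exact key p hp⟩

end Scaling

/-- For a continuous bounded positive function `E` on an open set
`𝒰 ⊆ ℝ^d`, the sets `π(K(E(y)))` are nonempty and compact, the map `y ↦ π(K(E(y)))` is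
continuous for the Hausdorff distance, and `⋃_{y ∈ 𝒰} π(K(E(y)))` is bounded. -/
theorem K_continuous_in_e (n : ℕ) (hn : 2 ≤ n) (μm μp : ℝ) (hμm : 0 < μm) (hμ : μm < μp)
    (d : ℕ) (hd : 1 ≤ d) (𝒰 : Set (EuclideanSpace ℝ (Fin d))) (hUopen : IsOpen 𝒰)
    (E : EuclideanSpace ℝ (Fin d) → ℝ) (hEpos : ∀ y ∈ 𝒰, 0 < E y)
    (hEcont : ContinuousOn E 𝒰) (hEbdd : ∃ B : ℝ, ∀ y ∈ 𝒰, E y ≤ B) :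
    (∀ y ∈ 𝒰, (pz '' Kset n μm μp (E y)).Nonempty ∧ IsCompact (pz '' Kset n μm μp (E y))) ∧
    (∀ y ∈ 𝒰, ∀ ε > (0 : ℝ), ∃ δ > (0 : ℝ), ∀ y' ∈ 𝒰, dist y y' < δ →
      Metric.hausdorffDist (pz '' Kset n μm μp (E y)) (pz '' Kset n μm μp (E y')) < ε) ∧
    Bornology.IsBounded (⋃ y ∈ 𝒰, pz '' Kset n μm μp (E y)) := by
  have hcomp := fun e => isCompact_image_Kset (n := n) hμm (hμm.trans hμ) e
  obtain ⟨R, hR0, hR⟩ := (hcomp 1).isBounded.exists_pos_norm_le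
  refine ⟨fun y hy => ⟨nonempty_image_Kset (by lia) μp hμm (hEpos y hy).le, hcomp _⟩, ?_, ?_⟩
  · intro y hy ε hε
    have hcont : ContinuousOn (fun y' => (|√(E y) - √(E y')| + |E y - E y'|) * R) 𝒰 := by
      fun_prop
    obtain ⟨δ, hδ, h⟩ := Metric.continuousOn_iff.1 hcont y hy ε hε
    refine ⟨δ, hδ, fun y' hy' hd' => ?_⟩
    refine (hausdorffDist_image_Kset_le (hEpos y hy) (hEpos y' hy') hR0.le hR).trans_lt ?_
    have := h y' hy' (by rwa [dist_comm])
    simp only [sub_self, abs_zero, add_zero, zero_mul, Real.dist_eq, sub_zero] at this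
    exact (le_abs_self _).trans_lt this
  · obtain ⟨B, hB⟩ := hEbdd
    refine isBounded_iff_forall_norm_le.2 ⟨(1 + √B + B) * R, fun q hq => ?_⟩
    obtain ⟨y, hy, hqy⟩ := Set.mem_iUnion₂.1 hq
    rw [image_Kset_eq_energyScale (hEpos y hy)] at hqy
    obtain ⟨p, hp, rfl⟩ := hqy
    have hE := (hEpos y hy).le
    have hEB := hB y hy
    calc ‖energyScale (E y) p‖ ≤ (1 + √(E y) + E y) * ‖p‖ := norm_energyScale_le hE p
      _ ≤ (1 + √B + B) * R := by
        have := hE.trans hEB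
        gcongr
        exact hR p hp
end
end
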